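/- arXiv:math/9905039 — 2 statements merged into one kernel-verified Lean document; each statement's English description precedes it below -/
import Mathlib

section
/- Radial weighted Hardy inequality in the regular case with a nonzero exponent (the case a_ℓ = 0, β ≠ 0 of Lemma 4.1(2)): let β ∈ ℝ with β ≠ 0, k ∈ ℤ, and 0 < r₁ < 1. Then there exists C > 0 such that for every measurable f : (0, r₁) → ℂ with ∫_0^{r₁} |f(r)|² · r^{2β+1} · |log r|^{k} dr < ∞, the function u defined by u(r) = −∫_r^{r₁} f(ρ) dρ if β > 0, and by u(r) = ∫_0^{r} f(ρ) dρ if β < 0, is well defined and satisfies ∫_0^{r₁} |u(r)|² · r^{2β−1} · |log r|^{k−2} dr ≤ C · ∫_0^{r₁} |f(r)|² · r^{2β+1} · |log r|^{k} dr. -/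
open MeasureTheory

lemma neg_log_zpow_comparison {b ε : ℝ} (hb0 : 0 < b) (hb1 : b < 1) (hε : 0 < ε) (k : ℤ) :
    ∃ C > (0 : ℝ), ∀ s t : ℝ, 0 < s → s ≤ t → t < b →
      (-Real.log s) ^ k ≤ C * ((-Real.log t) ^ k * (t / s) ^ ε) ∧
      (-Real.log t) ^ k ≤ C * ((-Real.log s) ^ k * (t / s) ^ ε) := by
  set n := k.natAbs with hn
  set δ : ℝ := ε / (n + 1) with hδ
  have hδ0 : 0 < δ := by positivity
  have hb : 0 < -Real.log b := by linarith [Real.log_neg hb0 hb1]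
  refine ⟨(1 + 1 / (δ * -Real.log b)) ^ n, by positivity, fun s t hs hst ht => ?_⟩
  have ht0 : 0 < t := hs.trans_le hst
  have hLt : -Real.log b ≤ -Real.log t := by linarith [Real.log_le_log ht0 ht.le]
  have hLt0 : 0 < -Real.log t := hb.trans_le hLt
  have hLs : -Real.log t ≤ -Real.log s := by linarith [Real.log_le_log hs hst]
  have hLs0 : 0 < -Real.log s := hLt0.trans_le hLs
  have hx : 1 ≤ t / s := (one_le_div hs).2 hst
  have hx0 : 0 < t / s := by positivity
  have hxδ : 1 ≤ (t / s) ^ δ := Real.one_le_rpow hx hδ0.le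
  have hq1 : 1 ≤ -Real.log s / -Real.log t := (one_le_div hLt0).2 hLs
  have hq : -Real.log s / -Real.log t ≤ (1 + 1 / (δ * -Real.log b)) * (t / s) ^ δ := by
    have h1 := Real.log_le_rpow_div hx0.le hδ0
    rw [Real.log_div ht0.ne' hs.ne'] at h1
    have h2 : (t / s) ^ δ / δ ≤ (t / s) ^ δ / δ / -Real.log b * -Real.log t := by
      rw [div_mul_eq_mul_div, le_div_iff₀ hb]
      gcongr
    rw [div_le_iff₀ hLt0]
    have h3 : -Real.log t ≤ (t / s) ^ δ * -Real.log t := le_mul_of_one_le_left hLt0.le hxδ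
    have h4 : (1 + 1 / (δ * -Real.log b)) * (t / s) ^ δ * -Real.log t
        = (t / s) ^ δ * -Real.log t + (t / s) ^ δ / δ / -Real.log b * -Real.log t := by
      field_simp
      ring
    rw [h4]
    linarith
  have hpow : (-Real.log s / -Real.log t) ^ n
      ≤ (1 + 1 / (δ * -Real.log b)) ^ n * (t / s) ^ ε := by
    refine (pow_le_pow_left₀ (by positivity) hq n).trans ?_
    rw [mul_pow, ← Real.rpow_mul_natCast hx0.le]
    gcongr
    rw [hδ, div_mul_eq_mul_div, div_le_iff₀ (by positivity)]
    nlinarith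
  have key : ∀ m : ℤ, m ≤ n → (-Real.log s / -Real.log t) ^ m
      ≤ (1 + 1 / (δ * -Real.log b)) ^ n * (t / s) ^ ε := fun m hm =>
    (zpow_le_zpow_right₀ hq1 hm).trans (by rwa [zpow_natCast])
  constructor
  · have h := key k (by omega)
    rw [div_zpow, div_le_iff₀ (by positivity)] at h
    linarith
  · have h := key (-k) (by omega)
    rw [zpow_neg, ← inv_zpow, inv_div, div_zpow, div_le_iff₀ (by positivity)] at h
    linarith

lemma setLIntegral_Ioo_zero_rpow_sub_one {c x : ℝ} (hc : 0 < c) (hx : 0 < x) :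
    ∫⁻ t in Set.Ioo 0 x, ENNReal.ofReal (t ^ (c - 1)) = ENNReal.ofReal (x ^ c / c) := by
  have hi : IntegrableOn (fun t : ℝ => t ^ (c - 1)) (Set.Ioo 0 x) :=
    (intervalIntegral.integrableOn_Ioo_rpow_iff hx).2 (by linarith)
  rw [← ofReal_integral_eq_lintegral_ofReal hi, ← integral_Ioc_eq_integral_Ioo,
    ← intervalIntegral.integral_of_le hx.le, integral_rpow (Or.inl (by linarith))]
  · simp [Real.zero_rpow hc.ne']
  · filter_upwards [ae_restrict_mem measurableSet_Ioo] with t ht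
    exact Real.rpow_nonneg ht.1.le _

lemma setLIntegral_Ioi_rpow_neg_sub_one {c x : ℝ} (hc : 0 < c) (hx : 0 < x) :
    ∫⁻ t in Set.Ioi x, ENNReal.ofReal (t ^ (-c - 1)) = ENNReal.ofReal (x ^ (-c) / c) := by
  have hi : IntegrableOn (fun t : ℝ => t ^ (-c - 1)) (Set.Ioi x) :=
    integrableOn_Ioi_rpow_of_lt (by linarith) hx
  rw [← ofReal_integral_eq_lintegral_ofReal hi, integral_Ioi_rpow_of_lt (by linarith) hx]
  · rw [sub_add_cancel, neg_div_neg_eq]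
  · filter_upwards [ae_restrict_mem measurableSet_Ioi] with t ht
    exact Real.rpow_nonneg (hx.trans ht).le _

lemma sq_setLIntegral_enorm_le {f : ℝ → ℂ} (hf : Measurable f) {S : Set ℝ}
    (hS : MeasurableSet S) (hS0 : S ⊆ Set.Ioi 0) (β : ℝ) :
    (∫⁻ ρ in S, ‖f ρ‖ₑ) ^ 2 ≤
      (∫⁻ ρ in S, ENNReal.ofReal (ρ ^ (-β - 1))) *
        ∫⁻ ρ in S, ENNReal.ofReal (‖f ρ‖ ^ 2 * ρ ^ (β + 1)) := by
  set g : ℝ → ENNReal := fun ρ => ENNReal.ofReal (ρ ^ ((-β - 1) / 2)) with hg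
  set h : ℝ → ENNReal := fun ρ => ENNReal.ofReal (‖f ρ‖ * ρ ^ ((β + 1) / 2)) with hh
  have hgm : Measurable g := by fun_prop
  have hhm : Measurable h := by fun_prop
  have e0 : ∫⁻ ρ in S, ‖f ρ‖ₑ = ∫⁻ ρ in S, (g * h) ρ := by
    refine setLIntegral_congr_fun hS fun ρ hρ => ?_
    have h0 : 0 < ρ := hS0 hρ
    simp only [hg, hh, Pi.mul_apply]
    rw [← ENNReal.ofReal_mul (by positivity), ← ofReal_norm]
    congr 1
    rw [mul_left_comm, ← Real.rpow_add h0]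
    ring_nf
    simp
  have e1 : ∫⁻ ρ in S, g ρ ^ (2 : ℝ) = ∫⁻ ρ in S, ENNReal.ofReal (ρ ^ (-β - 1)) := by
    refine setLIntegral_congr_fun hS fun ρ hρ => ?_
    have h0 : 0 < ρ := hS0 hρ
    simp only [hg]
    rw [ENNReal.rpow_two, ← ENNReal.ofReal_pow (by positivity), ← Real.rpow_mul_natCast h0.le]
    norm_num
  have e2 : ∫⁻ ρ in S, h ρ ^ (2 : ℝ)
      = ∫⁻ ρ in S, ENNReal.ofReal (‖f ρ‖ ^ 2 * ρ ^ (β + 1)) := by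
    refine setLIntegral_congr_fun hS fun ρ hρ => ?_
    have h0 : 0 < ρ := hS0 hρ
    simp only [hh]
    rw [ENNReal.rpow_two, ← ENNReal.ofReal_pow (by positivity), mul_pow,
      ← Real.rpow_mul_natCast h0.le]
    norm_num
  have key := ENNReal.lintegral_mul_le_Lp_mul_Lq (volume.restrict S) Real.HolderConjugate.two_two
    hgm.aemeasurable hhm.aemeasurable
  rw [e0, ← e1, ← e2]
  refine (pow_le_pow_left₀ zero_le key 2).trans_eq ?_
  rw [mul_pow, ← ENNReal.rpow_mul_natCast, ← ENNReal.rpow_mul_natCast]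
  norm_num

section WeightedHardy

variable {I : Set ℝ} {K : Set (ℝ × ℝ)} {w : ℝ → ℝ} {β A B C : ℝ} {f : ℝ → ℂ}

lemma setLIntegral_enorm_lt_top_of_weighted (hI0 : I ⊆ Set.Ioi 0)
    {S : Set ℝ} (hS : MeasurableSet S) (hSI : S ⊆ I) {r : ℝ} (hr : r ∈ I)
    (hw : ∀ r ∈ I, 0 < w r) (hC : 0 < C)
    (h1 : ∫⁻ ρ in S, ENNReal.ofReal (ρ ^ (-β - 1)) < ⊤)
    (hcomp : ∀ ρ ∈ S, w r ≤ C * (w ρ * (ρ / r) ^ (β / 2)))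
    (hmono : ∀ ρ ∈ S, r ^ (β / 2) ≤ ρ ^ (β / 2)) (hf : Measurable f)
    (hfin : ∫⁻ ρ in I, ENNReal.ofReal (‖f ρ‖ ^ 2 * ρ ^ (2 * β + 1) * w ρ) < ⊤) :
    ∫⁻ ρ in S, ‖f ρ‖ₑ < ⊤ := by
  have hr0 : 0 < r := hI0 hr
  have hwr := hw r hr
  have hlt : ∫⁻ ρ in S, ENNReal.ofReal (‖f ρ‖ ^ 2 * ρ ^ (β + 1)) < ⊤ := by
    calc ∫⁻ ρ in S, ENNReal.ofReal (‖f ρ‖ ^ 2 * ρ ^ (β + 1))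
        ≤ ∫⁻ ρ in S, ENNReal.ofReal (C / (w r * r ^ β)) *
            ENNReal.ofReal (‖f ρ‖ ^ 2 * ρ ^ (2 * β + 1) * w ρ) := by
          refine setLIntegral_mono' hS fun ρ hρ => ?_
          have h0 : 0 < ρ := hI0 (hSI hρ)
          have hwρ := hw ρ (hSI hρ)
          rw [← ENNReal.ofReal_mul (by positivity)]
          refine ENNReal.ofReal_le_ofReal ?_
          rw [div_mul_eq_mul_div, le_div_iff₀ (by positivity)]
          have hc := hcomp ρ hρ
          have hm := hmono ρ hρ
          rw [Real.div_rpow h0.le hr0.le] at hc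
          have e1 : r ^ β = r ^ (β / 2) * r ^ (β / 2) := by
            rw [← Real.rpow_add hr0]; ring_nf
          have e2 : ρ ^ (2 * β + 1) = ρ ^ (β + 1) * (ρ ^ (β / 2) * ρ ^ (β / 2)) := by
            rw [← Real.rpow_add h0, ← Real.rpow_add h0]; ring_nf
          have hrp : 0 < r ^ (β / 2) := by positivity
          have hρp : 0 < ρ ^ (β / 2) := by positivity
          have : w r * r ^ β ≤ C * (w ρ * (ρ ^ (β / 2) * ρ ^ (β / 2))) := by
            calc w r * r ^ β
                ≤ C * (w ρ * (ρ ^ (β / 2) / r ^ (β / 2))) * (r ^ (β / 2) * r ^ (β / 2)) := by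
                  rw [e1]; gcongr
              _ = C * (w ρ * (ρ ^ (β / 2) * r ^ (β / 2))) := by field_simp
              _ ≤ _ := by gcongr
          calc ‖f ρ‖ ^ 2 * ρ ^ (β + 1) * (w r * r ^ β)
              ≤ ‖f ρ‖ ^ 2 * ρ ^ (β + 1) * (C * (w ρ * (ρ ^ (β / 2) * ρ ^ (β / 2)))) := by gcongr
            _ = _ := by rw [e2]; ring
      _ = ENNReal.ofReal (C / (w r * r ^ β)) *
            ∫⁻ ρ in S, ENNReal.ofReal (‖f ρ‖ ^ 2 * ρ ^ (2 * β + 1) * w ρ) :=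
          lintegral_const_mul' _ _ ENNReal.ofReal_ne_top
      _ ≤ ENNReal.ofReal (C / (w r * r ^ β)) *
            ∫⁻ ρ in I, ENNReal.ofReal (‖f ρ‖ ^ 2 * ρ ^ (2 * β + 1) * w ρ) := by
          gcongr
      _ < ⊤ := ENNReal.mul_lt_top ENNReal.ofReal_lt_top hfin
  have hsq := (sq_setLIntegral_enorm_le hf hS (hSI.trans hI0) β).trans_lt
    (ENNReal.mul_lt_top h1 hlt)
  exact (ENNReal.pow_lt_top_iff.1 hsq).resolve_right two_ne_zero

lemma weighted_hardy_of_comparison (hI : MeasurableSet I) (hI0 : I ⊆ Set.Ioi 0)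
    (hK : MeasurableSet K) (hwm : Measurable w) (hw : ∀ r ∈ I, 0 < w r)
    (hA : 0 < A) (hB : 0 < B) (hC : 0 < C)
    (h1 : ∀ r ∈ I, ∫⁻ ρ in I ∩ {ρ | (r, ρ) ∈ K}, ENNReal.ofReal (ρ ^ (-β - 1))
      ≤ ENNReal.ofReal (A * r ^ (-β)))
    (h2 : ∀ ρ ∈ I, ∫⁻ r in I ∩ {r | (r, ρ) ∈ K}, ENNReal.ofReal (r ^ (β / 2 - 1))
      ≤ ENNReal.ofReal (B * ρ ^ (β / 2)))
    (hcomp : ∀ r ∈ I, ∀ ρ ∈ I, (r, ρ) ∈ K → w r ≤ C * (w ρ * (ρ / r) ^ (β / 2)))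
    (hf : Measurable f) :
    ∫⁻ r in I, ENNReal.ofReal (r ^ (2 * β - 1) * w r) *
        (∫⁻ ρ in I ∩ {ρ | (r, ρ) ∈ K}, ‖f ρ‖ₑ) ^ 2
      ≤ ENNReal.ofReal (A * B * C) *
        ∫⁻ ρ in I, ENNReal.ofReal (‖f ρ‖ ^ 2 * ρ ^ (2 * β + 1) * w ρ) := by
  set G : ℝ → ENNReal := fun ρ =>
    ENNReal.ofReal (‖f ρ‖ ^ 2 * ρ ^ (3 * β / 2 + 1) * w ρ) with hG
  have hGm : Measurable G := by fun_prop
  have hKr : ∀ r, MeasurableSet {ρ | (r, ρ) ∈ K} := fun r => measurable_prodMk_left hK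
  have hKρ : ∀ ρ, MeasurableSet {r | (r, ρ) ∈ K} := fun ρ => measurable_prodMk_right hK
  set F : ℝ → ℝ → ENNReal := fun r ρ =>
    K.indicator (fun p => ENNReal.ofReal (p.1 ^ (β / 2 - 1)) * G p.2) (r, ρ) with hF
  have hFm : Measurable (Function.uncurry F) := by
    have : Measurable fun p : ℝ × ℝ => ENNReal.ofReal (p.1 ^ (β / 2 - 1)) * G p.2 := by fun_prop
    exact this.indicator hK
  calc _ ≤ ∫⁻ r in I, ENNReal.ofReal (A * C) * ∫⁻ ρ in I, F r ρ := by
        refine setLIntegral_mono' hI fun r hr => ?_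
        have hr0 : 0 < r := hI0 hr
        have hwr := hw r hr
        have hS : MeasurableSet (I ∩ {ρ | (r, ρ) ∈ K}) := hI.inter (hKr r)
        have hFr : ∫⁻ ρ in I, F r ρ = ∫⁻ ρ in I ∩ {ρ | (r, ρ) ∈ K},
            ENNReal.ofReal (r ^ (β / 2 - 1)) * G ρ := by
          rw [Set.inter_comm, ← Measure.restrict_restrict (hKr r), ← lintegral_indicator (hKr r)]
          rfl
        calc _ ≤ ENNReal.ofReal (r ^ (2 * β - 1) * w r) * (ENNReal.ofReal (A * r ^ (-β)) *
                ∫⁻ ρ in I ∩ {ρ | (r, ρ) ∈ K}, ENNReal.ofReal (‖f ρ‖ ^ 2 * ρ ^ (β + 1))) := by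
              gcongr
              refine (sq_setLIntegral_enorm_le hf hS (Set.inter_subset_left.trans hI0) β).trans ?_
              gcongr
              exact h1 r hr
          _ ≤ _ := by
              rw [hFr, ← mul_assoc, ← ENNReal.ofReal_mul (by positivity),
                ← lintegral_const_mul' _ _ ENNReal.ofReal_ne_top,
                ← lintegral_const_mul' _ _ ENNReal.ofReal_ne_top]
              refine setLIntegral_mono' hS fun ρ hρ => ?_
              have h0 : 0 < ρ := hI0 hρ.1
              have hwρ := hw ρ hρ.1
              have hc := hcomp r hr ρ hρ.1 hρ.2
              rw [Real.div_rpow h0.le hr0.le] at hc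
              simp only [hG]
              rw [← ENNReal.ofReal_mul (by positivity), ← ENNReal.ofReal_mul (by positivity),
                ← ENNReal.ofReal_mul (by positivity)]
              refine ENNReal.ofReal_le_ofReal ?_
              have e1 : r ^ (2 * β - 1) * r ^ (-β) = r ^ (β / 2 - 1) * r ^ (β / 2) := by
                rw [← Real.rpow_add hr0, ← Real.rpow_add hr0]; ring_nf
              have e2 : ρ ^ (3 * β / 2 + 1) = ρ ^ (β + 1) * ρ ^ (β / 2) := by
                rw [← Real.rpow_add h0]; ring_nf
              have hrp : 0 < r ^ (β / 2) := by positivity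
              calc r ^ (2 * β - 1) * w r * (A * r ^ (-β)) * (‖f ρ‖ ^ 2 * ρ ^ (β + 1))
                  = (r ^ (2 * β - 1) * r ^ (-β)) * A * (‖f ρ‖ ^ 2 * ρ ^ (β + 1)) * w r := by ring
                _ ≤ (r ^ (2 * β - 1) * r ^ (-β)) * A * (‖f ρ‖ ^ 2 * ρ ^ (β + 1)) *
                    (C * (w ρ * (ρ ^ (β / 2) / r ^ (β / 2)))) := by gcongr
                _ = _ := by
                    rw [e1, e2]
                    field_simp
    _ = ENNReal.ofReal (A * C) * ∫⁻ ρ in I, ∫⁻ r in I, F r ρ := by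
        rw [lintegral_const_mul' _ _ ENNReal.ofReal_ne_top,
          lintegral_lintegral_swap hFm.aemeasurable]
    _ ≤ ENNReal.ofReal (A * C) * ∫⁻ ρ in I, ENNReal.ofReal B *
          ENNReal.ofReal (‖f ρ‖ ^ 2 * ρ ^ (2 * β + 1) * w ρ) := by
        refine mul_le_mul_right (setLIntegral_mono' hI fun ρ hρ => ?_) _
        have h0 : 0 < ρ := hI0 hρ
        have hwρ := hw ρ hρ
        have hFρ : ∫⁻ r in I, F r ρ = ∫⁻ r in I ∩ {r | (r, ρ) ∈ K},
            ENNReal.ofReal (r ^ (β / 2 - 1)) * G ρ := by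
          rw [Set.inter_comm, ← Measure.restrict_restrict (hKρ ρ), ← lintegral_indicator (hKρ ρ)]
          rfl
        rw [hFρ, lintegral_mul_const' _ _ ENNReal.ofReal_ne_top]
        refine (mul_le_mul_left (h2 ρ hρ) _).trans_eq ?_
        rw [← ENNReal.ofReal_mul (by positivity), ← ENNReal.ofReal_mul (by positivity)]
        congr 1
        have e2 : ρ ^ (2 * β + 1) = ρ ^ (β / 2) * ρ ^ (3 * β / 2 + 1) := by
          rw [← Real.rpow_add h0]; ring_nf
        rw [e2]
        ring
    _ = _ := by
        rw [lintegral_const_mul' _ _ ENNReal.ofReal_ne_top, ← mul_assoc,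
          ← ENNReal.ofReal_mul (by positivity)]
        ring_nf

end WeightedHardy

/-- Radial weighted Hardy inequality in the regular case with a nonzero exponent
(the case `a_ℓ = 0`, `β ≠ 0` of Lemma 4.1(2)).  Here `|log r| = -log r` for `0 < r < 1`. -/
theorem hardy_radial_regular (β : ℝ) (hβ : β ≠ 0) (k : ℤ) (r₁ : ℝ)
    (hr₁0 : 0 < r₁) (hr₁1 : r₁ < 1) :
    ∃ C > (0 : ℝ), ∀ f : ℝ → ℂ, Measurable f →
      (∫⁻ r in Set.Ioo (0 : ℝ) r₁,
          ENNReal.ofReal (‖f r‖ ^ 2 * r ^ (2 * β + 1) * (-Real.log r) ^ k) < ⊤) →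
      ((0 < β → ∀ r ∈ Set.Ioo (0 : ℝ) r₁, IntegrableOn f (Set.Ioo r r₁)) ∧
       (β < 0 → ∀ r ∈ Set.Ioo (0 : ℝ) r₁, IntegrableOn f (Set.Ioo 0 r)) ∧
       ∫⁻ r in Set.Ioo (0 : ℝ) r₁,
          ENNReal.ofReal
            (‖(if 0 < β then -∫ ρ in Set.Ioo r r₁, f ρ else ∫ ρ in Set.Ioo 0 r, f ρ)‖ ^ 2 *
              r ^ (2 * β - 1) * (-Real.log r) ^ (k - 2))
        ≤ ENNReal.ofReal C *
          ∫⁻ r in Set.Ioo (0 : ℝ) r₁,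
            ENNReal.ofReal (‖f r‖ ^ 2 * r ^ (2 * β + 1) * (-Real.log r) ^ k)) := by
  obtain ⟨C, hC, hcomp⟩ := neg_log_zpow_comparison hr₁0 hr₁1 (half_pos (abs_pos.2 hβ)) k
  set I := Set.Ioo (0 : ℝ) r₁ with hIdef
  set K : Set (ℝ × ℝ) := {p | if 0 < β then p.1 < p.2 else p.2 < p.1} with hKdef
  set D : ℝ := -Real.log r₁ with hD
  have hD0 : 0 < D := by linarith [Real.log_neg hr₁0 hr₁1]
  have hlog : ∀ r ∈ I, D ≤ -Real.log r := fun r hr => by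
    linarith [Real.log_le_log hr.1 hr.2.le]
  have hI : MeasurableSet I := measurableSet_Ioo
  have hI0 : I ⊆ Set.Ioi 0 := fun r hr => hr.1
  have hK : MeasurableSet K := by
    by_cases h : 0 < β
    · simpa [hKdef, h] using measurableSet_lt measurable_fst measurable_snd
    · simpa [hKdef, h] using measurableSet_lt measurable_snd measurable_fst
  have hwm : Measurable fun r : ℝ => (-Real.log r) ^ k := by fun_prop
  have hw : ∀ r ∈ I, 0 < (-Real.log r) ^ k := fun r hr => zpow_pos (hD0.trans_le (hlog r hr)) k
  have hA : 0 < 1 / |β| := by positivity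
  have hB : 0 < 2 / |β| := by positivity
  have hE : ∀ r ∈ I, I ∩ {ρ | (r, ρ) ∈ K} = if 0 < β then Set.Ioo r r₁ else Set.Ioo 0 r := by
    intro r hr
    split_ifs with h <;> ext ρ <;> simp only [hIdef, hKdef, h, if_true, if_false, Set.mem_inter_iff,
      Set.mem_Ioo, Set.mem_ofPred_eq] <;> constructor
    · exact fun ⟨h1, h2⟩ => ⟨h2, h1.2⟩
    · exact fun ⟨h1, h2⟩ => ⟨⟨hr.1.trans h1, h2⟩, h1⟩
    · exact fun ⟨h1, h2⟩ => ⟨h1.1, h2⟩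
    · exact fun ⟨h1, h2⟩ => ⟨⟨h1, h2.trans hr.2⟩, h2⟩
  have h1 : ∀ r ∈ I, ∫⁻ ρ in I ∩ {ρ | (r, ρ) ∈ K}, ENNReal.ofReal (ρ ^ (-β - 1))
      ≤ ENNReal.ofReal (1 / |β| * r ^ (-β)) := by
    intro r hr
    rcases hβ.lt_or_gt with h | h
    · refine (lintegral_mono_set (t := Set.Ioo 0 r) fun ρ hρ => ?_).trans
        ((setLIntegral_Ioo_zero_rpow_sub_one (neg_pos.2 h) hr.1).trans_le ?_)
      · rw [hE r hr, if_neg h.not_gt] at hρ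
        exact hρ
      · rw [abs_of_neg h, one_div_mul_eq_div]
    · refine (lintegral_mono_set (t := Set.Ioi r) fun ρ hρ => ?_).trans
        ((setLIntegral_Ioi_rpow_neg_sub_one h hr.1).trans_le ?_)
      · rw [hE r hr, if_pos h] at hρ
        exact hρ.1
      · rw [abs_of_pos h, one_div_mul_eq_div]
  have h2 : ∀ ρ ∈ I, ∫⁻ r in I ∩ {r | (r, ρ) ∈ K}, ENNReal.ofReal (r ^ (β / 2 - 1))
      ≤ ENNReal.ofReal (2 / |β| * ρ ^ (β / 2)) := by
    intro ρ hρ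
    rcases hβ.lt_or_gt with h | h
    · have e := setLIntegral_Ioi_rpow_neg_sub_one (c := -(β / 2)) (by linarith) hρ.1
      rw [neg_neg] at e
      refine (lintegral_mono_set (t := Set.Ioi ρ) fun r hr => ?_).trans (e.trans_le ?_)
      · simpa [hKdef, h.not_gt] using hr.2
      · rw [abs_of_neg h]
        refine ENNReal.ofReal_le_ofReal (le_of_eq ?_)
        field_simp
    · refine (lintegral_mono_set (t := Set.Ioo 0 ρ) fun r hr => ?_).trans
        ((setLIntegral_Ioo_zero_rpow_sub_one (half_pos h) hρ.1).trans_le ?_)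
      · exact ⟨hr.1.1, by simpa [hKdef, h] using hr.2⟩
      · rw [abs_of_pos h]
        refine ENNReal.ofReal_le_ofReal (le_of_eq ?_)
        field_simp
  have hc : ∀ r ∈ I, ∀ ρ ∈ I, (r, ρ) ∈ K →
      (-Real.log r) ^ k ≤ C * ((-Real.log ρ) ^ k * (ρ / r) ^ (β / 2)) := by
    intro r hr ρ hρ hp
    rcases hβ.lt_or_gt with h | h
    · have hlt : ρ < r := by simpa [hKdef, h.not_gt] using hp
      have := (hcomp ρ r hρ.1 hlt.le hr.2).2
      rwa [abs_of_neg h, neg_div, Real.rpow_neg (div_nonneg hr.1.le hρ.1.le),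
        ← Real.inv_rpow (div_nonneg hr.1.le hρ.1.le), inv_div] at this
    · have hlt : r < ρ := by simpa [hKdef, h] using hp
      have := (hcomp r ρ hr.1 hlt.le hρ.2).1
      rwa [abs_of_pos h] at this
  have hmono : ∀ r ∈ I, ∀ ρ ∈ I, (r, ρ) ∈ K → r ^ (β / 2) ≤ ρ ^ (β / 2) := by
    intro r hr ρ hρ hp
    rcases hβ.lt_or_gt with h | h
    · have hlt : ρ < r := by simpa [hKdef, h.not_gt] using hp
      exact Real.rpow_le_rpow_of_nonpos hρ.1 hlt.le (by linarith)
    · have hlt : r < ρ := by simpa [hKdef, h] using hp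
      exact Real.rpow_le_rpow hr.1.le hlt.le (by linarith)
  refine ⟨1 / D ^ 2 * (1 / |β| * (2 / |β|) * C), by positivity, fun f hf hfin => ?_⟩
  have hf_int : ∀ r ∈ I, IntegrableOn f (if 0 < β then Set.Ioo r r₁ else Set.Ioo 0 r) := by
    intro r hr
    rw [← hE r hr]
    exact ⟨hf.aestronglyMeasurable, setLIntegral_enorm_lt_top_of_weighted hI0
      (hI.inter (measurable_prodMk_left hK)) Set.inter_subset_left hr hw hC
      ((h1 r hr).trans_lt ENNReal.ofReal_lt_top) (fun ρ hρ => hc r hr ρ hρ.1 hρ.2)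
      (fun ρ hρ => hmono r hr ρ hρ.1 hρ.2) hf hfin⟩
  refine ⟨fun h r hr => by simpa [h] using hf_int r hr,
    fun h r hr => by simpa [h.not_gt] using hf_int r hr, ?_⟩
  rw [ENNReal.ofReal_mul (by positivity), mul_assoc]
  refine le_trans ?_ (mul_le_mul_right
    (weighted_hardy_of_comparison hI hI0 hK hwm hw hA hB hC h1 h2 hc hf) _)
  rw [← lintegral_const_mul' _ _ ENNReal.ofReal_ne_top]
  refine setLIntegral_mono' hI fun r hr => ?_
  have hL : 0 < -Real.log r := hD0.trans_le (hlog r hr)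
  have hr0 : 0 < r := hr.1
  have hnorm : ‖(if 0 < β then -∫ ρ in Set.Ioo r r₁, f ρ else ∫ ρ in Set.Ioo 0 r, f ρ)‖ₑ
      ≤ ∫⁻ ρ in I ∩ {ρ | (r, ρ) ∈ K}, ‖f ρ‖ₑ := by
    rw [hE r hr]
    split_ifs
    · rw [enorm_neg]
      exact enorm_integral_le_lintegral_enorm _
    · exact enorm_integral_le_lintegral_enorm _
  rw [mul_assoc, ENNReal.ofReal_mul (by positivity), ENNReal.ofReal_pow (norm_nonneg _),
    ofReal_norm, mul_comm, ← mul_assoc, ← ENNReal.ofReal_mul (by positivity)]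
  gcongr ENNReal.ofReal ?_ * ?_ ^ 2
  rw [zpow_sub₀ hL.ne', mul_left_comm, one_div_mul_eq_div]
  gcongr
  have := hlog r hr
  rw [zpow_ofNat]
  gcongr
end

section
/- Hardy-type inequality with a nondecreasing weight: let a < b be real numbers, let w : [a,b] → ℝ be positive and nondecreasing (s ≤ t implies w(s) ≤ w(t)), and let g : [a,b] → ℂ be measurable with ∫_a^b |g(t)|²·w(t) dt < ∞. Define u(θ) = ∫_{θ}^{b} g(t) dt for θ ∈ [a,b]. Then ∫_a^b |u(θ)|²·w(θ) dθ ≤ (b − a)² · ∫_a^b |g(θ)|²·w(θ) dθ. -/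
open MeasureTheory

/-- The Cauchy-Schwarz inequality against the constant function `1`. -/
theorem lintegral_sq_le_measure_univ_mul {α : Type*} [MeasurableSpace α] (μ : Measure α)
    {f : α → ENNReal} (hf : AEMeasurable f μ) :
    (∫⁻ x, f x ∂μ) ^ 2 ≤ μ Set.univ * ∫⁻ x, f x ^ 2 ∂μ := by
  have h := ENNReal.lintegral_mul_le_Lp_mul_Lq μ Real.HolderConjugate.two_two hf
    (aemeasurable_const (b := (1 : ENNReal)))
  simp only [Pi.mul_apply, mul_one, ENNReal.rpow_two, one_pow, lintegral_one] at h
  have hroot (x : ENNReal) : (x ^ (1 / 2 : ℝ)) ^ 2 = x := by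
    rw [← ENNReal.rpow_two, ← ENNReal.rpow_mul]
    norm_num
  calc (∫⁻ x, f x ∂μ) ^ 2
      ≤ ((∫⁻ x, f x ^ 2 ∂μ) ^ (1 / 2 : ℝ) * μ Set.univ ^ (1 / 2 : ℝ)) ^ 2 := by
        gcongr
    _ = μ Set.univ * ∫⁻ x, f x ^ 2 ∂μ := by rw [mul_pow, hroot, hroot, mul_comm]

theorem ofReal_norm_sq_mul {E : Type*} [SeminormedAddCommGroup E] (z : E) (c : ℝ) :
    ENNReal.ofReal (‖z‖ ^ 2 * c) = ENNReal.ofReal c * ‖z‖ₑ ^ 2 := by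
  rw [ENNReal.ofReal_mul (by positivity), ENNReal.ofReal_pow (norm_nonneg _), ofReal_norm,
    mul_comm]

/-- Hardy-type inequality with a positive nondecreasing weight. -/
theorem hardy_nondecreasing_weight (a b : ℝ) (hab : a < b) (w : ℝ → ℝ) (g : ℝ → ℂ)
    (hw_pos : ∀ t ∈ Set.Icc a b, 0 < w t)
    (hw_mono : ∀ s ∈ Set.Icc a b, ∀ t ∈ Set.Icc a b, s ≤ t → w s ≤ w t)
    (hg : Measurable g)
    (hfin : ∫⁻ t in Set.Icc a b, ENNReal.ofReal (‖g t‖ ^ 2 * w t) < ⊤) :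
    ∫⁻ θ in Set.Icc a b, ENNReal.ofReal (‖∫ t in θ..b, g t‖ ^ 2 * w θ)
      ≤ ENNReal.ofReal ((b - a) ^ 2) *
        ∫⁻ θ in Set.Icc a b, ENNReal.ofReal (‖g θ‖ ^ 2 * w θ) := by
  simp only [ofReal_norm_sq_mul]
  set I := ∫⁻ t in Set.Icc a b, ENNReal.ofReal (w t) * ‖g t‖ₑ ^ 2
  have key : ∀ θ ∈ Set.Icc a b,
      ENNReal.ofReal (w θ) * ‖∫ t in θ..b, g t‖ₑ ^ 2 ≤ ENNReal.ofReal (b - a) * I := by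
    intro θ hθ
    have hsub : Set.Ioc θ b ⊆ Set.Icc a b := fun t ht => ⟨hθ.1.trans ht.1.le, ht.2⟩
    calc ENNReal.ofReal (w θ) * ‖∫ t in θ..b, g t‖ₑ ^ 2
        ≤ ENNReal.ofReal (w θ) * (∫⁻ t in Set.Ioc θ b, ‖g t‖ₑ) ^ 2 := by
          rw [intervalIntegral.integral_of_le hθ.2]
          gcongr
          exact enorm_integral_le_lintegral_enorm _
      _ ≤ ENNReal.ofReal (w θ) *
            (ENNReal.ofReal (b - θ) * ∫⁻ t in Set.Ioc θ b, ‖g t‖ₑ ^ 2) := by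
          gcongr
          simpa using lintegral_sq_le_measure_univ_mul (volume.restrict (Set.Ioc θ b))
            hg.enorm.aemeasurable
      _ = ENNReal.ofReal (b - θ) *
            ∫⁻ t in Set.Ioc θ b, ENNReal.ofReal (w θ) * ‖g t‖ₑ ^ 2 := by
          rw [lintegral_const_mul _ (hg.enorm.pow_const 2), mul_left_comm]
      _ ≤ ENNReal.ofReal (b - a) *
            ∫⁻ t in Set.Ioc θ b, ENNReal.ofReal (w t) * ‖g t‖ₑ ^ 2 := by
          refine mul_le_mul' (ENNReal.ofReal_le_ofReal (by linarith [hθ.1])) ?_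
          refine setLIntegral_mono' measurableSet_Ioc fun t ht => ?_
          gcongr
          exact hw_mono θ hθ t (hsub ht) ht.1.le
      _ ≤ ENNReal.ofReal (b - a) * I := by
          gcongr
          exact lintegral_mono_set hsub
  calc ∫⁻ θ in Set.Icc a b, ENNReal.ofReal (w θ) * ‖∫ t in θ..b, g t‖ₑ ^ 2
      ≤ ∫⁻ _ in Set.Icc a b, ENNReal.ofReal (b - a) * I :=
        setLIntegral_mono' measurableSet_Icc key
    _ = ENNReal.ofReal ((b - a) ^ 2) * I := by
        rw [setLIntegral_const, Real.volume_Icc, ENNReal.ofReal_pow (by linarith)]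
        ring
end
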